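/- Let (T_0, T_1, …, T_R) be exchangeable real-valued random variables, i.e., the joint law of (T_{π(0)}, …, T_{π(R)}) equals that of (T_0, …, T_R) for every permutation π of {0, 1, …, R}. Define the permutation p-value p = (1/(R+1))·#{r ∈ {0, 1, …, R} : T_r ≤ T_0}. Then for every α ∈ [0,1], Pr(p ≤ α) ≤ α. -/

import Mathlib

open MeasureTheory Finset
open scoped Classical

/-- Vectors whose `j`-th coordinate has small normalized rank. -/
def lowRank (R : ℕ) (α : ℝ) (j : Fin (R + 1)) : Set (Fin (R + 1) → ℝ) :=
  {x | ((R : ℝ) + 1)⁻¹ *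
    ((Finset.univ.filter fun r : Fin (R + 1) => x r ≤ x j).card : ℝ) ≤ α}

lemma measurableSet_lowRank (R : ℕ) (α : ℝ) (j : Fin (R + 1)) :
    MeasurableSet (lowRank R α j) := by
  unfold lowRank
  apply measurableSet_le _ measurable_const
  apply Measurable.const_mul
  simp only [Finset.card_filter, Nat.cast_sum]
  refine Finset.measurable_sum _ fun r _ => ?_
  simp only [Nat.cast_ite, Nat.cast_one, Nat.cast_zero]
  exact Measurable.ite (measurableSet_le (measurable_pi_apply r) (measurable_pi_apply j))
    measurable_const measurable_const

lemma card_lowRank (R : ℕ) (α : ℝ) (hα0 : 0 ≤ α) (x : Fin (R + 1) → ℝ) :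
    ((Finset.univ.filter fun j => x ∈ lowRank R α j).card : ℝ) ≤ ((R : ℝ) + 1) * α := by
  have hR : (0 : ℝ) < (R : ℝ) + 1 := by positivity
  rcases (Finset.univ.filter fun j => x ∈ lowRank R α j).eq_empty_or_nonempty with h | h
  · rw [h]; simp only [Finset.card_empty, Nat.cast_zero]; positivity
  · obtain ⟨j, hj, hmax⟩ := Finset.exists_max_image _ x h
    have h1 := (Finset.mem_filter.1 hj).2
    unfold lowRank at h1
    rw [Set.mem_setOf_eq, inv_mul_le_iff₀ hR] at h1
    refine le_trans ?_ h1
    exact_mod_cast Finset.card_le_card fun r hr =>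
      Finset.mem_filter.2 ⟨Finset.mem_univ _, hmax r hr⟩

/-- **finite-sample validity of permutation tests.**
Let `(T_0, T_1, …, T_R)` be exchangeable real random variables: the joint law of
`(T_{π(0)}, …, T_{π(R)})` equals that of `(T_0, …, T_R)` for every permutation `π` of
`{0, 1, …, R}`. Define the permutation p-value
`p = (1/(R+1))·#{r : T_r ≤ T_0}`. Then for every `α ∈ [0,1]`, `Pr(p ≤ α) ≤ α`. -/
theorem stmt5
    {Ω : Type*} [MeasurableSpace Ω] (P : Measure Ω) [IsProbabilityMeasure P]
    (R : ℕ) (T : Fin (R + 1) → Ω → ℝ)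
    (hmeas : ∀ r, Measurable (T r))
    (hexch : ∀ π : Equiv.Perm (Fin (R + 1)),
      Measure.map (fun ω r => T (π r) ω) P = Measure.map (fun ω r => T r ω) P)
    (α : ℝ) (hα0 : 0 ≤ α) (hα1 : α ≤ 1) :
    (P {ω | ((R : ℝ) + 1)⁻¹ *
        ((Finset.univ.filter fun r : Fin (R + 1) => T r ω ≤ T 0 ω).card : ℝ) ≤ α}).toReal
      ≤ α := by
  have hR : (0 : ℝ) < (R : ℝ) + 1 := by positivity
  have hm : Measurable (fun ω r => T r ω) := measurable_pi_lambda _ hmeas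
  set μ := Measure.map (fun ω r => T r ω) P with hμ
  haveI : IsProbabilityMeasure μ := Measure.isProbabilityMeasure_map hm.aemeasurable
  have h0 : P {ω | ((R : ℝ) + 1)⁻¹ *
        ((Finset.univ.filter fun r : Fin (R + 1) => T r ω ≤ T 0 ω).card : ℝ) ≤ α}
      = μ (lowRank R α 0) := by
    rw [hμ, Measure.map_apply hm (measurableSet_lowRank R α 0)]
    rfl
  have hj : ∀ j, μ (lowRank R α j) = μ (lowRank R α 0) := by
    intro j
    conv_rhs => rw [← hexch (Equiv.swap 0 j), Measure.map_apply
      (measurable_pi_lambda _ fun r => hmeas _) (measurableSet_lowRank R α 0)]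
    rw [hμ, Measure.map_apply hm (measurableSet_lowRank R α j)]
    congr 1
    ext ω
    simp only [lowRank, Set.mem_preimage, Set.mem_setOf_eq, Equiv.swap_apply_left]
    have : (Finset.univ.filter fun r => T r ω ≤ T j ω).card =
        (Finset.univ.filter fun r => T (Equiv.swap 0 j r) ω ≤ T j ω).card := by
      refine Finset.card_equiv (Equiv.swap 0 j) fun i => ?_
      simp
    rw [this]
  have hsum : ∑ j, μ.real (lowRank R α j) ≤ ((R : ℝ) + 1) * α := by
    have e : ∀ j, μ.real (lowRank R α j)
        = ∫ x, (lowRank R α j).indicator (fun _ => (1 : ℝ)) x ∂μ := fun j => by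
      rw [integral_indicator_const _ (measurableSet_lowRank R α j)]; simp
    have hi : ∀ j ∈ (Finset.univ : Finset (Fin (R + 1))),
        Integrable ((lowRank R α j).indicator (fun _ => (1 : ℝ))) μ := fun j _ =>
      (integrable_const _).indicator (measurableSet_lowRank R α j)
    simp only [e]
    rw [← integral_finsetSum _ hi]
    calc _ ≤ ∫ _, ((R : ℝ) + 1) * α ∂μ := by
          refine integral_mono (integrable_finsetSum _ hi) (integrable_const _) fun x => ?_
          refine le_trans (le_of_eq ?_) (card_lowRank R α hα0 x)
          simp [Set.indicator_apply]
      _ = _ := by simp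
  rw [h0]
  simp only [Measure.real, hj, Finset.sum_const, Finset.card_univ, Fintype.card_fin,
    nsmul_eq_mul] at hsum
  push_cast at hsum
  exact le_of_mul_le_mul_left hsum hR
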